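/- arXiv:2310.10869 — 2 statements merged into one kernel-verified Lean document; each statement's English description precedes it below -/
import Mathlib

section
/- Let σ be an absolutely continuous probability measure on ℝⁿ with finite second moment, μ a probability measure on ℝⁿ with finite second moment, and P = [θ₁, …, θₙ] ∈ O(n). Let T(x) = Σᵢ₌₁ⁿ fᵢ(⟨x, θᵢ⟩) θᵢ, where each fᵢ : ℝ → ℝ is a strictly increasing continuous bijection of ℝ, and assume T_♯σ has finite second moment. Then T_{σ,μ;P} = T_{T_♯σ,μ;P} ∘ T holds σ-almost everywhere, and consequently (T_{T_♯σ,μ;P})_♯(T_♯σ) = (T_{σ,μ;P})_♯σ; i.e., the slice-matching operator 𝒰(σ, μ, P) := (T_{σ,μ;P})_♯σ is invariant under the action of such P-compatible maps on the source measure. -/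
open MeasureTheory Filter
open scoped ENNReal RealInnerProductSpace BigOperators Topology

noncomputable section

namespace SliceMatching

/-- `ℝⁿ` with its Euclidean structure. -/
abbrev Rn (n : ℕ) := EuclideanSpace ℝ (Fin n)

/-- The cumulative distribution function of a measure on `ℝ`. -/
def cdf (ν : Measure ℝ) (t : ℝ) : ℝ := (ν (Set.Iic t)).toReal

/-- The quantile function (pseudo-inverse of the CDF) of a measure on `ℝ`. -/
def quantile (ρ : Measure ℝ) (p : ℝ) : ℝ := sInf {t : ℝ | p ≤ cdf ρ t}

/-- The one-dimensional optimal transport map `T_ν^ρ = F_ρ⁻¹ ∘ F_ν`. -/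
def otMap1d (ν ρ : Measure ℝ) (t : ℝ) : ℝ := quantile ρ (cdf ν t)

/-- The slice `σ^θ`: pushforward of `σ` under the projection `x ↦ ⟪x, θ⟫`. -/
def slice {n : ℕ} (σ : Measure (Rn n)) (θ : Rn n) : Measure ℝ :=
  σ.map (fun x => ⟪x, θ⟫)

/-- The matrix-slice matching map `T_{σ,μ;P}`, where `P ∈ O(n)` has columns `θ 0, …, θ (n-1)`:
`T_{σ,μ;P}(x) = ∑ i, T_{σ^{θ i}}^{μ^{θ i}}(⟪x, θ i⟫) • θ i`. -/
def smMap {n : ℕ} (σ μ : Measure (Rn n)) (θ : Fin n → Rn n) (x : Rn n) : Rn n :=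
  ∑ i, otMap1d (slice σ (θ i)) (slice μ (θ i)) ⟪x, θ i⟫ • θ i

/-- The squared quadratic Wasserstein distance: the infimum of `∫ ‖x - y‖²` over all
couplings of `σ` and `μ`. -/
def W2sq {α : Type*} [MeasurableSpace α] [NormedAddCommGroup α] (σ μ : Measure α) : ℝ :=
  (⨅ (π : Measure (α × α)) (_ : π.map Prod.fst = σ ∧ π.map Prod.snd = μ),
    ∫⁻ p, ENNReal.ofReal (‖p.1 - p.2‖ ^ 2) ∂π).toReal

/-- The quadratic Wasserstein distance `W₂`. -/
def W2 {α : Type*} [MeasurableSpace α] [NormedAddCommGroup α] (σ μ : Measure α) : ℝ :=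
  Real.sqrt (W2sq σ μ)

theorem cdf_eq_probabilityTheory_cdf (ρ : Measure ℝ) [IsProbabilityMeasure ρ] :
    cdf ρ = ProbabilityTheory.cdf ρ := by
  ext t
  rw [ProbabilityTheory.cdf_eq_real]
  rfl

theorem monotone_cdf (ρ : Measure ℝ) [IsProbabilityMeasure ρ] : Monotone (cdf ρ) := by
  rw [cdf_eq_probabilityTheory_cdf]
  exact ProbabilityTheory.monotone_cdf ρ

theorem quantile_of_nonpos (ρ : Measure ℝ) {p : ℝ} (hp : p ≤ 0) : quantile ρ p = 0 := by
  have h : {t : ℝ | p ≤ cdf ρ t} = Set.univ :=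
    Set.eq_univ_of_forall fun _ => hp.trans ENNReal.toReal_nonneg
  rw [quantile, h, Real.sInf_univ]

theorem quantile_of_one_lt (ρ : Measure ℝ) [IsProbabilityMeasure ρ] {p : ℝ} (hp : 1 < p) :
    quantile ρ p = 0 := by
  have h : {t : ℝ | p ≤ cdf ρ t} = ∅ := by
    refine Set.eq_empty_of_forall_notMem fun t ht => ?_
    have h1 : cdf ρ t ≤ 1 := by
      rw [cdf_eq_probabilityTheory_cdf]
      exact ProbabilityTheory.cdf_le_one ρ t
    exact absurd (hp.trans_le ht) h1.not_gt
  rw [quantile, h, Real.sInf_empty]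

theorem monotoneOn_quantile (ρ : Measure ℝ) [IsProbabilityMeasure ρ] :
    MonotoneOn (quantile ρ) (Set.Ioo 0 1) := by
  intro p hp q hq hpq
  refine csInf_le_csInf ?_ ?_ fun t ht => hpq.trans ht
  · obtain ⟨a, ha⟩ := ((ProbabilityTheory.tendsto_cdf_atBot ρ).eventually_lt_const hp.1).exists
    refine ⟨a, fun t ht => ?_⟩
    by_contra! hlt
    have h1 := monotone_cdf ρ hlt.le
    rw [Set.mem_ofPred_eq] at ht
    rw [← cdf_eq_probabilityTheory_cdf] at ha
    linarith
  · obtain ⟨a, ha⟩ := ((ProbabilityTheory.tendsto_cdf_atTop ρ).eventually_const_lt hq.2).exists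
    rw [← cdf_eq_probabilityTheory_cdf] at ha
    exact ⟨a, ha.le⟩

theorem measurable_quantile (ρ : Measure ℝ) [IsProbabilityMeasure ρ] :
    Measurable (quantile ρ) := by
  refine measurable_of_restrict_of_restrict_compl (s := Set.Ioo 0 1) measurableSet_Ioo
    ?_ ?_
  · exact Monotone.measurable fun p q hpq => monotoneOn_quantile ρ p.2 q.2 hpq
  have h : (Set.Ioo (0 : ℝ) 1)ᶜ.domRestrict (quantile ρ) =
      fun p : ↥(Set.Ioo (0 : ℝ) 1)ᶜ => Set.indicator {(1 : ℝ)} (fun _ => quantile ρ 1) (p : ℝ) := by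
    ext ⟨p, hp⟩
    rw [Set.mem_compl_iff, Set.mem_Ioo, not_and_or, not_lt, not_lt] at hp
    by_cases h1 : p = 1
    · simp [h1]
    · rcases hp with hp | hp
      · simp [h1, quantile_of_nonpos ρ hp]
      · simp [h1, quantile_of_one_lt ρ (hp.lt_of_ne' h1)]
  rw [h]
  exact (measurable_const.indicator (measurableSet_singleton _)).comp measurable_subtype_coe

theorem measurable_otMap1d (ν ρ : Measure ℝ) [IsProbabilityMeasure ν] [IsProbabilityMeasure ρ] :
    Measurable (otMap1d ν ρ) :=
  (measurable_quantile ρ).comp (monotone_cdf ν).measurable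

instance isProbabilityMeasure_slice {n : ℕ} (σ : Measure (Rn n)) [IsProbabilityMeasure σ]
    (θ : Rn n) : IsProbabilityMeasure (slice σ θ) :=
  Measure.isProbabilityMeasure_map (by fun_prop)

theorem measurable_smMap {n : ℕ} (σ μ : Measure (Rn n)) [IsProbabilityMeasure σ]
    [IsProbabilityMeasure μ] (θ : Fin n → Rn n) : Measurable (smMap σ μ θ) := by
  unfold smMap
  refine Finset.measurable_sum _ fun i _ => Measurable.smul_const ?_ _
  exact (measurable_otMap1d _ _).comp (by fun_prop)

theorem cdf_map_apply_of_strictMono (ν : Measure ℝ) {g : ℝ → ℝ} (hg : StrictMono g) (t : ℝ) :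
    cdf (ν.map g) (g t) = cdf ν t := by
  have h : g ⁻¹' Set.Iic (g t) = Set.Iic t := by
    ext s
    simp [hg.le_iff_le]
  rw [cdf, Measure.map_apply hg.monotone.measurable measurableSet_Iic, h, cdf]

theorem otMap1d_map_apply_of_strictMono (ν ρ : Measure ℝ) {g : ℝ → ℝ} (hg : StrictMono g)
    (t : ℝ) : otMap1d (ν.map g) ρ (g t) = otMap1d ν ρ t := by
  rw [otMap1d, cdf_map_apply_of_strictMono ν hg, otMap1d]

theorem slice_map {n : ℕ} (σ : Measure (Rn n)) {θ : Rn n} {T : Rn n → Rn n} {g : ℝ → ℝ}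
    (hT : Measurable T) (hg : Measurable g) (h : ∀ x, ⟪T x, θ⟫ = g ⟪x, θ⟫) :
    slice (σ.map T) θ = (slice σ θ).map g := by
  rw [slice, slice, Measure.map_map (by fun_prop) hT, Measure.map_map hg (by fun_prop)]
  exact congrArg (σ.map ·) (funext h)

/-- Invariance of the slice-matching operator
`𝒰(σ, μ, P) = (T_{σ,μ;P})_♯σ` under `P`-compatible actions on the source measure. -/
theorem stmt2 {n : ℕ}
    (σ μ : Measure (Rn n)) [IsProbabilityMeasure σ] [IsProbabilityMeasure μ]
    (hac : σ ≪ volume)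
    (hσ2 : Integrable (fun x => ‖x‖ ^ 2) σ) (hμ2 : Integrable (fun y => ‖y‖ ^ 2) μ)
    (θ : Fin n → Rn n) (hθ : Orthonormal ℝ θ)
    (f : Fin n → ℝ → ℝ)
    (hf : ∀ i, StrictMono (f i) ∧ Continuous (f i) ∧ Function.Bijective (f i))
    (T : Rn n → Rn n) (hT : ∀ x, T x = ∑ i, f i ⟪x, θ i⟫ • θ i)
    (hT2 : Integrable (fun x => ‖x‖ ^ 2) (σ.map T)) :
    smMap σ μ θ =ᵐ[σ] (smMap (σ.map T) μ θ) ∘ T ∧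
    (σ.map T).map (smMap (σ.map T) μ θ) = σ.map (smMap σ μ θ) := by
  have hTm : Measurable T := by
    rw [funext hT]
    exact Finset.measurable_sum _ fun i _ =>
      ((hf i).1.monotone.measurable.comp (by fun_prop)).smul_const _
  have hinner (i : Fin n) (x : Rn n) : ⟪T x, θ i⟫ = f i ⟪x, θ i⟫ := by
    rw [hT, hθ.inner_left_fintype]
    rfl
  have heq : smMap σ μ θ = smMap (σ.map T) μ θ ∘ T := by
    ext1 x
    refine Finset.sum_congr rfl fun i _ => ?_
    rw [slice_map σ hTm (hf i).1.monotone.measurable (hinner i), hinner,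
      otMap1d_map_apply_of_strictMono _ _ (hf i).1]
  have : IsProbabilityMeasure (σ.map T) := Measure.isProbabilityMeasure_map hTm.aemeasurable
  exact ⟨.of_eq heq, by rw [Measure.map_map (measurable_smMap _ μ θ) hTm, ← heq]⟩

end SliceMatching
end
end

section
/- Let σ be an absolutely continuous probability measure on ℝⁿ with finite second moment, let a > 0 and b ∈ ℝⁿ, set S(x) = ax + b, and let μ = S_♯σ. Then for every orthogonal matrix P ∈ O(n), the matrix-slice matching map satisfies T_{σ,μ;P}(x) = ax + b for σ-almost every x ∈ ℝⁿ, and (T_{σ,μ;P})_♯σ = μ. -/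
open MeasureTheory Filter
open scoped ENNReal RealInnerProductSpace BigOperators Topology

noncomputable section

namespace SliceMatching

/-- Almost every `t` is a point of left increase of the distribution function. -/
lemma ae_cdf_le_cdf_iff (ν : Measure ℝ) [IsFiniteMeasure ν] :
    ∀ᵐ t ∂ν, ∀ s, cdf ν t ≤ cdf ν s ↔ t ≤ s := by
  have hnull : ∀ q : ℚ, ν {t : ℝ | (q : ℝ) < t ∧ ν (Set.Ioc (q : ℝ) t) = 0} = 0 := by
    intro q
    refine measure_null_of_locally_null _ fun t ht => ?_
    by_cases h : ∃ t', t < t' ∧ ν (Set.Ioc (q : ℝ) t') = 0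
    · obtain ⟨t', htt', h0⟩ := h
      exact ⟨_, mem_nhdsWithin_of_mem_nhds (Ioc_mem_nhds ht.1 htt'), h0⟩
    · push Not at h
      refine ⟨_, mem_of_superset self_mem_nhdsWithin fun u hu => ?_, ht.2⟩
      exact ⟨hu.1, not_lt.1 fun hlt => h u hlt hu.2⟩
  have hae : ∀ᵐ t ∂ν, ∀ q : ℚ, ¬((q : ℝ) < t ∧ ν (Set.Ioc (q : ℝ) t) = 0) := by
    refine ae_all_iff.2 fun q => ?_
    rw [ae_iff]
    simpa only [not_not] using hnull q
  filter_upwards [hae] with t ht s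
  constructor
  · intro h
    by_contra! hst
    obtain ⟨q, hsq, hqt⟩ := exists_rat_btwn hst
    refine ht q ⟨hqt, measure_mono_null (Set.Ioc_subset_Ioc_left hsq.le) ?_⟩
    have hle : ν (Set.Iic t) ≤ ν (Set.Iic s) :=
      (ENNReal.toReal_le_toReal (measure_ne_top _ _) (measure_ne_top _ _)).1 h
    have hdiff : Set.Ioc s t = Set.Iic t \ Set.Iic s := by
      ext u
      simp [and_comm]
    rw [hdiff, measure_sdiff (Set.Iic_subset_Iic.2 hst.le)
      measurableSet_Iic.nullMeasurableSet (measure_ne_top _ _)]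
    exact tsub_eq_zero_of_le hle
  · intro h
    exact ENNReal.toReal_mono (measure_ne_top _ _) (measure_mono (Set.Iic_subset_Iic.2 h))

/-- The one-dimensional transport map onto an increasing affine image is that affine map. -/
lemma otMap1d_map_affine (ν : Measure ℝ) [IsFiniteMeasure ν] {a : ℝ} (ha : 0 < a) (c : ℝ) :
    ∀ᵐ t ∂ν, otMap1d ν (ν.map fun t => a * t + c) t = a * t + c := by
  have hcdf : ∀ s, cdf (ν.map fun t => a * t + c) s = cdf ν ((s - c) / a) := by
    intro s
    unfold cdf
    rw [Measure.map_apply (by fun_prop) measurableSet_Iic]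
    congr 2
    ext t
    simp only [Set.mem_preimage, Set.mem_Iic, le_div_iff₀ ha]
    constructor <;> intro h <;> linarith
  filter_upwards [ae_cdf_le_cdf_iff ν] with t ht
  have hset : {s | cdf ν t ≤ cdf (ν.map fun t => a * t + c) s} = Set.Ici (a * t + c) := by
    ext s
    simp only [Set.mem_ofPred_eq, Set.mem_Ici, hcdf, ht, le_div_iff₀ ha]
    constructor <;> intro h <;> linarith
  rw [otMap1d, quantile, hset, csInf_Ici]

/-- The slices of an affine image are affine images of the slices. -/
lemma slice_map_affine {n : ℕ} (σ : Measure (Rn n)) (a : ℝ) (b θ : Rn n) :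
    slice (σ.map fun x => a • x + b) θ = (slice σ θ).map fun t => a * t + ⟪b, θ⟫ := by
  unfold slice
  rw [Measure.map_map (by fun_prop) (by fun_prop), Measure.map_map (by fun_prop) (by fun_prop)]
  congr 1
  ext x
  simp [inner_add_left, real_inner_smul_left]

lemma sum_inner_smul_of_orthonormal {n : ℕ} {θ : Fin n → Rn n} (hθ : Orthonormal ℝ θ)
    (x : Rn n) : ∑ i, ⟪x, θ i⟫ • θ i = x := by
  have hspan : ⊤ ≤ Submodule.span ℝ (Set.range θ) :=
    (hθ.linearIndependent.span_eq_top_of_card_eq_finrank' (by simp)).ge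
  simpa [real_inner_comm] using (OrthonormalBasis.mk hθ hspan).sum_repr' x

/-- Exact recovery of translations-and-isotropic-scalings: if
`μ = (x ↦ a • x + b)_♯ σ` with `a > 0`, then for every orthogonal `P` the matrix-slice
matching map equals `x ↦ a • x + b` (σ-a.e.) and one step recovers `μ`. -/
theorem stmt4 {n : ℕ}
    (σ : Measure (Rn n)) [IsProbabilityMeasure σ] (hac : σ ≪ volume)
    (hσ2 : Integrable (fun x => ‖x‖ ^ 2) σ)
    (a : ℝ) (ha : 0 < a) (b : Rn n)
    (μ : Measure (Rn n)) (hμ : μ = σ.map (fun x => a • x + b))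
    (θ : Fin n → Rn n) (hθ : Orthonormal ℝ θ) :
    smMap σ μ θ =ᵐ[σ] (fun x => a • x + b) ∧
    σ.map (smMap σ μ θ) = μ := by
  have hae : smMap σ μ θ =ᵐ[σ] (fun x => a • x + b) := by
    have hcoord : ∀ᵐ x ∂σ, ∀ i, otMap1d (slice σ (θ i)) (slice μ (θ i)) ⟪x, θ i⟫ =
        a * ⟪x, θ i⟫ + ⟪b, θ i⟫ := by
      refine ae_all_iff.2 fun i => ?_
      have hm : Measurable fun x : Rn n => ⟪x, θ i⟫ := by fun_prop
      have : IsFiniteMeasure (slice σ (θ i)) := by unfold slice; infer_instance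
      rw [hμ, slice_map_affine]
      exact ae_of_ae_map hm.aemeasurable (otMap1d_map_affine (slice σ (θ i)) ha ⟪b, θ i⟫)
    filter_upwards [hcoord] with x hx
    rw [← sum_inner_smul_of_orthonormal hθ (a • x + b), smMap]
    refine Finset.sum_congr rfl fun i _ => ?_
    rw [hx i, inner_add_left, real_inner_smul_left]
  exact ⟨hae, by rw [Measure.map_congr hae, hμ]⟩

end SliceMatching
end
end
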